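/- arXiv:2511.03914 — 2 statements merged into one kernel-verified Lean document; each statement's English description precedes it below -/
import Mathlib

section
/- Helffer–Sjöstrand formula: for f ∈ C²(ℝ) with compact support, a cutoff χ ∈ C_c^∞(ℝ) with χ(0)=1, and the almost-analytic extension f̃(x+iy) := f(x) + iy·f'(x), one has for every real λ: f(λ) = (1/π) ∫_ℂ ∂_z̄ ( f̃(z) χ(Im z) ) / (λ − z) d²z, where ∂_z̄ = (∂_x + i∂_y)/2 and d²z is Lebesgue measure on ℂ. -/
open MeasureTheory

/-- The antiholomorphic derivative `∂_z̄ = (∂_x + i ∂_y)/2` of a function `F : ℂ → ℂ`,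
viewed through its real coordinates. -/
noncomputable def dbar (F : ℂ → ℂ) (z : ℂ) : ℂ :=
  (1 / 2) * (deriv (fun x : ℝ => F (x + z.im * Complex.I)) z.re
    + Complex.I * deriv (fun y : ℝ => F (z.re + y * Complex.I)) z.im)


lemma dbar_eq_fderiv (F : ℂ → ℂ) (hF : Differentiable ℝ F) (z : ℂ) :
    dbar F z = (1 / 2) * (fderiv ℝ F z 1 + Complex.I * fderiv ℝ F z Complex.I) := by
  have hz : ((z.re : ℂ) + z.im * Complex.I) = z := Complex.re_add_im z
  have h1 : HasDerivAt (fun x : ℝ => F (x + z.im * Complex.I)) (fderiv ℝ F z 1) z.re := by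
    have hl : HasDerivAt (fun x : ℝ => ((x : ℂ) + z.im * Complex.I)) 1 z.re :=
      (Complex.ofRealCLM.hasDerivAt (x := z.re)).add_const _
    have hd : HasFDerivAt F (fderiv ℝ F z) ((z.re : ℂ) + z.im * Complex.I) := by
      rw [hz]; exact (hF z).hasFDerivAt
    exact hd.comp_hasDerivAt z.re hl
  have h2 : HasDerivAt (fun y : ℝ => F (z.re + y * Complex.I))
      (fderiv ℝ F z Complex.I) z.im := by
    have hl : HasDerivAt (fun y : ℝ => ((z.re : ℂ) + y * Complex.I)) Complex.I z.im := by
      simpa using ((Complex.ofRealCLM.hasDerivAt (x := z.im)).mul_const Complex.I).const_add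
        (z.re : ℂ)
    have hd : HasFDerivAt F (fderiv ℝ F z) ((z.re : ℂ) + z.im * Complex.I) := by
      rw [hz]; exact (hF z).hasFDerivAt
    exact hd.comp_hasDerivAt z.im hl
  rw [dbar, h1.deriv, h2.deriv]

lemma alg_id (L : ℂ →L[ℝ] ℂ) (t : ℝ) (r : ℝ) (hr : 0 < r) :
    r • ((1 / 2) * (L 1 + Complex.I * L Complex.I) /
      (-((r : ℂ) * (Real.cos t + Real.sin t * Complex.I)))) =
    -(1 / 2) * L (Real.cos t + Real.sin t * Complex.I)
      + (-(1 / 2) * Complex.I) * L (-Real.sin t + Real.cos t * Complex.I) := by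
  have e1 : L (Real.cos t + Real.sin t * Complex.I)
      = Real.cos t * L 1 + Real.sin t * L Complex.I := by
    have : ((Real.cos t : ℂ) + Real.sin t * Complex.I)
      = Real.cos t • (1 : ℂ) + Real.sin t • Complex.I := by simp
    rw [this, map_add, map_smul, map_smul]; simp
  have e2 : L (-Real.sin t + Real.cos t * Complex.I)
      = -Real.sin t * L 1 + Real.cos t * L Complex.I := by
    have : (-(Real.sin t : ℂ) + Real.cos t * Complex.I)
      = (-Real.sin t) • (1 : ℂ) + Real.cos t • Complex.I := by simp
    rw [this, map_add, map_smul, map_smul]; simp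
  rw [e1, e2]
  have hr' : (r : ℂ) ≠ 0 := by exact_mod_cast hr.ne'
  have hcs : (Real.cos t : ℂ) ^ 2 + (Real.sin t : ℂ) ^ 2 = 1 := by
    exact_mod_cast Real.cos_sq_add_sin_sq t
  generalize (Real.cos t : ℂ) = c at *
  generalize (Real.sin t : ℂ) = s at *
  have hI : Complex.I ^ 2 = -1 := Complex.I_sq
  have hm : (c + s * Complex.I) * (c - s * Complex.I) = 1 := by
    linear_combination hcs - s ^ 2 * hI
  have hne : c + s * Complex.I ≠ 0 := left_ne_zero_of_mul_eq_one hm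
  rw [Complex.real_smul]
  have : (r : ℂ) * ((1 / 2) * (L 1 + Complex.I * L Complex.I) / (-((r : ℂ) * (c + s * Complex.I))))
      = -(1 / 2) * (L 1 + Complex.I * L Complex.I) * (c - s * Complex.I) := by
    rw [mul_div_assoc', div_eq_iff (neg_ne_zero.mpr (mul_ne_zero hr' hne))]
    linear_combination (-(1/2) * r * (L 1 + Complex.I * L Complex.I)) * hm
  rw [this]
  linear_combination ((1/2) * s * L Complex.I) * hI

lemma cauchy_pompeiu (F : ℂ → ℂ) (hF : ContDiff ℝ 1 F) (hc : HasCompactSupport F) (a : ℂ) :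
    ∫ z : ℂ, dbar F z / (a - z) = Real.pi * F a := by
  have hd : Differentiable ℝ F := hF.differentiable one_ne_zero
  have hDc : Continuous (fderiv ℝ F) := hF.continuous_fderiv one_ne_zero
  rw [← integral_add_left_eq_self (μ := volume) (fun z => dbar F z / (a - z)) a,
    ← Complex.integral_comp_polarCoord_symm]
  set e : ℝ → ℂ := fun t => Real.cos t + Real.sin t * Complex.I with he
  set e' : ℝ → ℂ := fun t => -Real.sin t + Real.cos t * Complex.I with he'
  have hec : Continuous e := by fun_prop
  have hec' : Continuous e' := by fun_prop
  set A : ℝ × ℝ → ℂ := fun p => fderiv ℝ F (a + p.1 * e p.2) (e p.2) with hA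
  set B : ℝ × ℝ → ℂ := fun p => fderiv ℝ F (a + p.1 * e p.2) (e' p.2) with hB
  have hAc : Continuous A := by
    apply Continuous.clm_apply <;> fun_prop
  have hBc : Continuous B := by
    apply Continuous.clm_apply <;> fun_prop
  have hne : ∀ t, ‖e t‖ = 1 := fun t => by
    have := Complex.norm_exp_ofReal_mul_I t
    rw [Complex.exp_mul_I] at this
    simpa [he] using this
  -- radius
  obtain ⟨R, hR0, hR⟩ : ∃ R : ℝ, 0 < R ∧ ∀ r t : ℝ, R < r → a + r * e t ∉ tsupport F := by
    obtain ⟨C, hC⟩ := hc.isCompact.isBounded.exists_norm_le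
    refine ⟨|C| + ‖a‖ + 1, by positivity, fun r t hr hm => ?_⟩
    have h1 := hC _ hm
    have h2 : ‖(r : ℂ) * e t‖ = |r| := by rw [norm_mul, hne]; simp
    have h3 : ‖(r : ℂ) * e t‖ ≤ ‖a + r * e t‖ + ‖a‖ := by
      have := norm_sub_le (a + r * e t) a
      simpa using this
    have := le_abs_self C
    have := le_abs_self r
    linarith
  have hD0 : ∀ r t : ℝ, R < r → fderiv ℝ F (a + r * e t) = 0 := fun r t hr => by
    by_contra h
    exact hR r t hr (support_fderiv_subset ℝ h)
  have hF0 : ∀ r t : ℝ, R < r → F (a + r * e t) = 0 := fun r t hr =>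
    image_eq_zero_of_notMem_tsupport (hR r t hr)
  have hint : ∀ G : ℝ × ℝ → ℂ, Continuous G → (∀ r t : ℝ, R < r → G (r, t) = 0) →
      IntegrableOn G (Set.Ioi 0 ×ˢ Set.Ioo (-Real.pi) Real.pi) := by
    intro G hG h0
    have hcpt : IsCompact (Set.Icc 0 R ×ˢ Set.Icc (-Real.pi) Real.pi) :=
      isCompact_Icc.prod isCompact_Icc
    refine (hG.continuousOn.integrableOn_compact hcpt (μ := volume)).of_forall_sdiff_eq_zero
      (measurableSet_Ioi.prod measurableSet_Ioo) ?_
    rintro ⟨r, t⟩ ⟨⟨h1, h2⟩, h3⟩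
    apply h0
    by_contra h
    exact h3 ⟨⟨le_of_lt h1, not_lt.mp h⟩, Set.Ioo_subset_Icc_self h2⟩
  have hAi := hint A hAc (fun r t h => by simp [hA, hD0 r t h])
  have hBi := hint B hBc (fun r t h => by simp [hB, hD0 r t h])
  have hcongr : ∀ p ∈ Set.Ioi (0 : ℝ) ×ˢ Set.Ioo (-Real.pi) Real.pi,
      p.1 • (dbar F (a + Complex.polarCoord.symm p) / (a - (a + Complex.polarCoord.symm p)))
       = -(1 / 2) * A p + (-(1 / 2) * Complex.I) * B p := by
    rintro ⟨r, t⟩ ⟨h1, h2⟩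
    rw [dbar_eq_fderiv F hd, Complex.polarCoord_symm_apply]
    have := alg_id (fderiv ℝ F (a + r * e t)) t r h1
    simp only [sub_add_cancel_left]
    exact this
  rw [polarCoord_target, setIntegral_congr_fun (measurableSet_Ioi.prod measurableSet_Ioo) hcongr,
    integral_add (hAi.const_mul _) (hBi.const_mul _), integral_const_mul, integral_const_mul]
  have hBz : ∫ p in Set.Ioi (0 : ℝ) ×ˢ Set.Ioo (-Real.pi) Real.pi, B p = 0 := by
    rw [Measure.volume_eq_prod, setIntegral_prod _ hBi]
    rw [setIntegral_congr_fun measurableSet_Ioi (g := fun _ => (0 : ℂ)) ?_]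
    · simp
    intro r hr
    have hr : (0 : ℝ) < r := hr
    have hder : ∀ t : ℝ, HasDerivAt (fun t => F (a + r * e t)) (r • B (r, t)) t := by
      intro t
      have h1 : HasDerivAt e (e' t) t := by
        have hc := (Real.hasDerivAt_cos t).ofReal_comp
        have hs := (Real.hasDerivAt_sin t).ofReal_comp
        have := hc.add (hs.mul_const Complex.I)
        rw [Complex.ofReal_neg] at this
        exact this
      have h2 : HasDerivAt (fun t => a + r * e t) (r * e' t) t := (h1.const_mul _).const_add _
      have h3 := (hd (a + r * e t)).hasFDerivAt.comp_hasDerivAt t h2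
      have h4 : (r : ℂ) * e' t = r • e' t := (Complex.real_smul).symm
      rw [h4, map_smul] at h3
      exact h3
    have hft := intervalIntegral.integral_eq_sub_of_hasDerivAt
      (a := -Real.pi) (b := Real.pi) (fun t _ => hder t)
      (Continuous.intervalIntegrable (by fun_prop) _ _)
    rw [intervalIntegral.integral_smul] at hft
    have hee : e Real.pi = e (-Real.pi) := by simp [he]
    rw [hee, sub_self, smul_eq_zero] at hft
    have := hft.resolve_left hr.ne'
    rw [intervalIntegral.integral_of_le (by linarith [Real.pi_pos]),
      integral_Ioc_eq_integral_Ioo] at this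
    exact this
  have hAz : ∫ p in Set.Ioi (0 : ℝ) ×ˢ Set.Ioo (-Real.pi) Real.pi, A p
      = -(2 * Real.pi * F a) := by
    rw [Measure.volume_eq_prod, ← setIntegral_prod_swap, setIntegral_prod (fun z : ℝ × ℝ => A z.swap) hAi.swap]
    rw [setIntegral_congr_fun measurableSet_Ioo (g := fun _ => - F a) ?_]
    · simp [Real.pi_pos.le]
      left
      ring
    intro t _
    have hder : ∀ r : ℝ, HasDerivAt (fun r : ℝ => F (a + r * e t)) (A (r, t)) r := by
      intro r
      have h2 : HasDerivAt (fun r : ℝ => a + r * e t) (e t) r := by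
        simpa using ((Complex.ofRealCLM.hasDerivAt (x := r)).mul_const (e t)).const_add a
      exact (hd (a + r * e t)).hasFDerivAt.comp_hasDerivAt r h2
    have hi : IntegrableOn (fun r : ℝ => A (r, t)) (Set.Ioi 0) := by
      have hcc : Continuous fun r : ℝ => A (r, t) := by fun_prop
      refine (hcc.continuousOn.integrableOn_compact (isCompact_Icc (a := 0) (b := R))
        (μ := volume)).of_forall_sdiff_eq_zero measurableSet_Ioi ?_
      rintro r ⟨h1, h3⟩
      have : R < r := by
        by_contra h
        exact h3 ⟨le_of_lt h1, not_lt.mp h⟩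
      simp [hA, hD0 r t this]
    have := integral_Ioi_of_hasDerivAt_of_tendsto' (a := 0) (m := 0) (fun r _ => hder r) hi
      (tendsto_const_nhds.congr' (by
        filter_upwards [Filter.eventually_gt_atTop R] with r hr
        exact (hF0 r t hr).symm))
    simpa using this
  rw [hAz, hBz]
  ring

theorem helffer_sjostrand (f : ℝ → ℝ) (hf : ContDiff ℝ 2 f) (hfc : HasCompactSupport f)
    (χ : ℝ → ℝ) (hχ : ContDiff ℝ (⊤ : ℕ∞) χ) (hχc : HasCompactSupport χ) (hχ0 : χ 0 = 1)
    (ftilde : ℂ → ℂ)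
    (hft : ∀ z : ℂ, ftilde z = ((f z.re : ℂ) + Complex.I * z.im * deriv f z.re) * χ z.im)
    (lam : ℝ) :
    (f lam : ℂ) = (1 / Real.pi) * ∫ z : ℂ, dbar ftilde z / ((lam : ℂ) - z) := by
  have hfe : ftilde = fun z : ℂ =>
    ((f z.re : ℂ) + Complex.I * z.im * deriv f z.re) * χ z.im := funext hft
  have hf1 : ContDiff ℝ 1 f := hf.of_le (by norm_num)
  have hf' : ContDiff ℝ 1 (deriv f) := by
    have : ContDiff ℝ (1 + 1) f := by convert hf using 1; norm_num
    exact (contDiff_succ_iff_deriv.mp this).2.2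
  have hχ1 : ContDiff ℝ 1 χ := hχ.of_le (by exact_mod_cast le_top)
  have hre : ContDiff ℝ 1 Complex.re := Complex.reCLM.contDiff
  have him : ContDiff ℝ 1 Complex.im := Complex.imCLM.contDiff
  have hof : ContDiff ℝ 1 (fun x : ℝ => (x : ℂ)) := Complex.ofRealCLM.contDiff
  have hC : ContDiff ℝ 1 ftilde := by
    rw [hfe]
    exact ((hof.comp (hf1.comp hre)).add ((contDiff_const.mul (hof.comp him)).mul
      (hof.comp (hf'.comp hre)))).mul (hof.comp (hχ1.comp him))
  have hS : HasCompactSupport ftilde := by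
    refine HasCompactSupport.intro (K := tsupport f ×ℂ tsupport χ)
      (hfc.isCompact.reProdIm hχc.isCompact) ?_
    intro z hz
    rw [hft]
    by_cases h1 : z.re ∈ tsupport f
    · have h2 : z.im ∉ tsupport χ := fun h => hz ⟨h1, h⟩
      simp [image_eq_zero_of_notMem_tsupport h2]
    · have h2 : deriv f z.re = 0 := by
        by_contra h
        exact h1 (support_deriv_subset h)
      simp [image_eq_zero_of_notMem_tsupport h1, h2]
  rw [cauchy_pompeiu ftilde hC hS, hft]
  have : (Real.pi : ℂ) ≠ 0 := by exact_mod_cast Real.pi_ne_zero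
  simp [hχ0]
end

section
/- The Stieltjes transform of the semicircle law satisfies the derivative bound |m'(z)| ≤ C·(Im z)^{−1/2} uniformly for z in the upper half-plane with |Re z| ≤ 4 and 0 < Im z ≤ 4, for some absolute constant C. -/
open MeasureTheory

noncomputable def rhoSC (x : ℝ) : ℝ := (1 / (2 * Real.pi)) * Real.sqrt (max (4 - x ^ 2) 0)

noncomputable def mSC (z : ℂ) : ℂ := ∫ x : ℝ, (rhoSC x : ℂ) / ((x : ℂ) - z)

lemma aux_sqrt (a b : ℝ) (hb : 0 ≤ b) : Real.sqrt a - Real.sqrt b ≤ Real.sqrt |a - b| := by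
  have h : Real.sqrt a ≤ Real.sqrt b + Real.sqrt |a - b| := by
    apply Real.sqrt_le_iff.2
    refine ⟨by positivity, ?_⟩
    have h1 := Real.sq_sqrt hb
    have h2 := Real.sq_sqrt (abs_nonneg (a - b))
    have h3 := le_abs_self (a - b)
    have h4 := Real.sqrt_nonneg b
    have h5 := Real.sqrt_nonneg |a - b|
    nlinarith [mul_nonneg h4 h5]
  linarith

lemma aux_lip1 (x y : ℝ) : max (4 - x ^ 2) 0 - max (4 - y ^ 2) 0 ≤ 4 * |x - y| := by
  have h0 := abs_nonneg (x - y)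
  have h1 := le_abs_self (x - y)
  have h2 := neg_le_abs (x - y)
  have hy := le_max_left (4 - y ^ 2) 0
  have hy' := le_max_right (4 - y ^ 2) 0
  rcases le_total (4 - x ^ 2) 0 with h | h
  · rw [max_eq_right h]; linarith
  · rw [max_eq_left h]
    have hx : |x| ≤ 2 := abs_le_of_sq_le_sq (by linarith) (by norm_num)
    obtain ⟨hx1, hx2⟩ := abs_le.1 hx
    nlinarith [sq_nonneg (x - y), mul_nonneg (sub_nonneg.2 hx2) (sub_nonneg.2 h1),
      mul_nonneg (sub_nonneg.2 hx2) (sub_nonneg.2 h2),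
      mul_nonneg (neg_le_iff_add_nonneg.1 hx1) (sub_nonneg.2 h1),
      mul_nonneg (neg_le_iff_add_nonneg.1 hx1) (sub_nonneg.2 h2)]

lemma aux_holder1 (x y : ℝ) : rhoSC x - rhoSC y ≤ Real.sqrt |x - y| := by
  unfold rhoSC
  have h1 := aux_sqrt (max (4 - x ^ 2) 0) (max (4 - y ^ 2) 0) (le_max_right _ _)
  have h2 : |max (4 - x ^ 2) 0 - max (4 - y ^ 2) 0| ≤ 2 ^ 2 * |x - y| := by
    rw [abs_le]
    have := aux_lip1 x y
    have := aux_lip1 y x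
    rw [abs_sub_comm y x] at this
    constructor <;> linarith
  have h3 := Real.sqrt_le_sqrt h2
  rw [Real.sqrt_mul (by positivity), Real.sqrt_sq (by norm_num)] at h3
  have h4 : Real.sqrt (max (4 - x ^ 2) 0) - Real.sqrt (max (4 - y ^ 2) 0) ≤ 2 * Real.sqrt |x - y| :=
    h1.trans h3
  have h5 := Real.sqrt_nonneg |x - y|
  have hpi := Real.pi_gt_three
  have h6 : 1 / (2 * Real.pi) ≤ 1 / 2 := by
    apply one_div_le_one_div_of_le <;> linarith
  have h7 : 0 ≤ 1 / (2 * Real.pi) := by positivity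
  calc _ = 1 / (2 * Real.pi) * (Real.sqrt (max (4 - x ^ 2) 0) - Real.sqrt (max (4 - y ^ 2) 0)) := by
        ring
    _ ≤ 1 / (2 * Real.pi) * (2 * Real.sqrt |x - y|) := by gcongr
    _ ≤ 1 / 2 * (2 * Real.sqrt |x - y|) := by gcongr
    _ = _ := by ring

lemma aux_holder (x y : ℝ) : |rhoSC x - rhoSC y| ≤ Real.sqrt |x - y| := by
  rw [abs_le]
  have := aux_holder1 x y
  have := aux_holder1 y x
  rw [abs_sub_comm y x] at this
  constructor <;> linarith

lemma aux_cont : Continuous rhoSC := by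
  unfold rhoSC; fun_prop

lemma aux_int : Integrable rhoSC := by
  apply aux_cont.integrable_of_hasCompactSupport
  apply HasCompactSupport.intro (isCompact_Icc (a := (-2 : ℝ)) (b := 2))
  intro x hx
  have : 4 - x ^ 2 ≤ 0 := by
    by_contra h
    apply hx
    have : |x| ≤ 2 := abs_le_of_sq_le_sq (by linarith) (by norm_num)
    exact abs_le.1 this
  simp [rhoSC, max_eq_right this]

lemma aux_ne (x : ℝ) (z : ℂ) (hz : 0 < z.im) : (x : ℂ) - z ≠ 0 := by
  intro h
  have := congrArg Complex.im h
  simp at this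
  linarith

lemma aux_norm (x : ℝ) (z : ℂ) (hz : 0 < z.im) :
    ‖1 / ((x : ℂ) - z) ^ 2‖ = (z.im ^ 2)⁻¹ * (1 + ((x - z.re) / z.im) ^ 2)⁻¹ := by
  rw [norm_div, norm_pow, ← Complex.normSq_eq_norm_sq, Complex.normSq_apply, norm_one, ← mul_inv,
    one_div]
  congr 1
  simp
  field_simp
  ring

lemma aux_int2 (z : ℂ) (hz : 0 < z.im) : Integrable (fun x : ℝ => 1 / ((x : ℂ) - z) ^ 2) := by
  have h := ((integrable_inv_one_add_sq.comp_div hz.ne').comp_sub_right z.re).const_mul (z.im ^ 2)⁻¹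
  refine h.mono' ?_ ?_
  · apply Continuous.aestronglyMeasurable
    exact continuous_const.div (by fun_prop) (fun x => pow_ne_zero _ (aux_ne x z hz))
  · exact Filter.Eventually.of_forall fun x => (aux_norm x z hz).le

lemma aux_zero (z : ℂ) (hz : 0 < z.im) : ∫ x : ℝ, 1 / ((x : ℂ) - z) ^ 2 = 0 := by
  have ht : Filter.Tendsto (fun x : ℝ => -((x : ℂ) - z)⁻¹) (Filter.cocompact ℝ) (nhds 0) := by
    rw [← neg_zero]
    apply Filter.Tendsto.neg
    apply Filter.tendsto_inv₀_cobounded.comp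
    rw [← tendsto_norm_atTop_iff_cobounded]
    refine Filter.tendsto_atTop_mono (f := fun x : ℝ => ‖x‖ + -‖z‖) (fun x => ?_) ?_
    · have := norm_sub_norm_le (x : ℂ) z
      rw [Complex.norm_real] at this
      linarith
    · exact Filter.tendsto_atTop_add_const_right _ _ (tendsto_norm_cocompact_atTop)
  have := integral_of_hasDerivAt_of_tendsto (f := fun x : ℝ => -((x : ℂ) - z)⁻¹)
    (f' := fun x : ℝ => 1 / ((x : ℂ) - z) ^ 2) (m := 0) (n := 0) ?_ (aux_int2 z hz)
    (ht.mono_left atBot_le_cocompact) (ht.mono_left atTop_le_cocompact)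
  · simpa using this
  · intro x
    have h := ((Complex.ofRealCLM.hasDerivAt (x := x)).sub_const z).inv (aux_ne x z hz)
    have h' := h.neg
    have e : -(-Complex.ofRealCLM 1 / (Complex.ofRealCLM x - z) ^ 2) = 1 / ((x : ℂ) - z) ^ 2 := by
      simp [neg_div]
    rw [e] at h'
    exact h'

lemma aux_deriv (z : ℂ) (hz : 0 < z.im) :
    Integrable (fun x : ℝ => (rhoSC x : ℂ) * (1 / ((x : ℂ) - z) ^ 2)) ∧
    HasDerivAt mSC (∫ x : ℝ, (rhoSC x : ℂ) * (1 / ((x : ℂ) - z) ^ 2)) z := by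
  have hs : {w : ℂ | z.im / 2 < w.im} ∈ nhds z :=
    (isOpen_lt continuous_const Complex.continuous_im).mem_nhds (by simp; linarith)
  have hc : ∀ w : ℂ, 0 < w.im → Continuous (fun x : ℝ => (rhoSC x : ℂ) / ((x : ℂ) - w)) := by
    intro w hw
    exact (Complex.continuous_ofReal.comp aux_cont).div (by fun_prop) (fun x => aux_ne x w hw)
  have hlow : ∀ (w : ℂ) (x : ℝ), |w.im| ≤ ‖(x : ℂ) - w‖ := by
    intro w x
    simpa using Complex.abs_im_le_norm ((x : ℂ) - w)
  refine hasDerivAt_integral_of_dominated_loc_of_deriv_le (s := {w : ℂ | z.im / 2 < w.im})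
    (F := fun (w : ℂ) (x : ℝ) => (rhoSC x : ℂ) / ((x : ℂ) - w))
    (F' := fun (w : ℂ) (x : ℝ) => (rhoSC x : ℂ) * (1 / ((x : ℂ) - w) ^ 2))
    (bound := fun x => |rhoSC x| * (1 / (z.im / 2) ^ 2)) hs ?_ ?_ ?_ ?_ ?_ ?_
  · filter_upwards [hs] with w hw
    exact (hc w (lt_trans (half_pos hz) hw)).aestronglyMeasurable
  · refine (aux_int.norm.mul_const (1 / z.im)).mono' (hc z hz).aestronglyMeasurable ?_
    refine Filter.Eventually.of_forall fun x => ?_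
    have := hlow z x
    rw [abs_of_pos hz] at this
    rw [norm_div, Complex.norm_real, div_eq_mul_one_div]
    gcongr
  · apply Continuous.aestronglyMeasurable
    exact (Complex.continuous_ofReal.comp aux_cont).mul
      (continuous_const.div (by fun_prop) (fun x => pow_ne_zero _ (aux_ne x z hz)))
  · refine Filter.Eventually.of_forall fun x w hw => ?_
    replace hw : z.im / 2 < w.im := hw
    have := hlow w x
    have h2 := le_abs_self w.im
    rw [norm_mul, Complex.norm_real, norm_div, norm_pow, norm_one, Real.norm_eq_abs]
    gcongr
    linarith
  · exact aux_int.norm.mul_const _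
  · refine Filter.Eventually.of_forall fun x w hw => ?_
    replace hw : z.im / 2 < w.im := hw
    have h := (((hasDerivAt_id w).const_sub (x : ℂ)).inv (aux_ne x w (by linarith))).const_mul
      (rhoSC x : ℂ)
    have e : -(-1 : ℂ) / ((x : ℂ) - w) ^ 2 = 1 / ((x : ℂ) - w) ^ 2 := by
      simp
    simp only [id_eq] at h
    rw [e] at h
    exact h

lemma aux_pt (u : ℝ) : Real.sqrt |u| * (1 + u ^ 2)⁻¹ ≤ (1 + ‖u‖ ^ 2) ^ (-(3 / 2 : ℝ) / 2) := by
  have hp : 0 < 1 + u ^ 2 := by positivity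
  have h1 : Real.sqrt |u| ≤ (1 + u ^ 2) ^ (1 / 4 : ℝ) := by
    have : Real.sqrt |u| = (u ^ 2) ^ (1 / 4 : ℝ) := by
      rw [Real.sqrt_eq_rpow, ← sq_abs, ← Real.rpow_natCast, ← Real.rpow_mul (abs_nonneg u)]
      norm_num
    rw [this]
    apply Real.rpow_le_rpow <;> first | positivity | linarith
  rw [Real.norm_eq_abs, sq_abs]
  calc _ ≤ (1 + u ^ 2) ^ (1 / 4 : ℝ) * (1 + u ^ 2)⁻¹ := by gcongr
    _ = _ := by
      rw [← Real.rpow_neg_one, ← Real.rpow_add hp]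
      norm_num

theorem mSC_deriv_bound :
    ∃ C : ℝ, 0 < C ∧ ∀ z : ℂ, |z.re| ≤ 4 → 0 < z.im → z.im ≤ 4 →
      ‖deriv mSC z‖ ≤ C * (z.im) ^ (-(1 / 2 : ℝ)) := by
  set G : ℝ → ℝ := fun u => (1 + ‖u‖ ^ 2) ^ (-(3 / 2 : ℝ) / 2) with hG
  have hGi : Integrable G := integrable_rpow_neg_one_add_norm_sq (by norm_num)
  have hG0 : 0 ≤ ∫ u, G u := integral_nonneg fun u => by simp only [hG]; positivity
  refine ⟨(∫ u, G u) + 1, by linarith, fun z _ hz _ => ?_⟩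
  obtain ⟨hi, hd⟩ := aux_deriv z hz
  have hz2 : ∫ x : ℝ, (rhoSC z.re : ℂ) * (1 / ((x : ℂ) - z) ^ 2) = 0 := by
    rw [integral_const_mul, aux_zero z hz, mul_zero]
  have e : deriv mSC z = ∫ x : ℝ, ((rhoSC x : ℂ) * (1 / ((x : ℂ) - z) ^ 2)
      - (rhoSC z.re : ℂ) * (1 / ((x : ℂ) - z) ^ 2)) := by
    rw [integral_sub hi ((aux_int2 z hz).const_mul _), hz2, sub_zero, hd.deriv]
  set c : ℝ := Real.sqrt z.im * (z.im ^ 2)⁻¹ with hc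
  have hgi : Integrable (fun x : ℝ => c * G ((x - z.re) / z.im)) :=
    ((hGi.comp_div hz.ne').comp_sub_right z.re).const_mul c
  have hint : ∫ x : ℝ, c * G ((x - z.re) / z.im) = z.im ^ (-(1 / 2 : ℝ)) * ∫ u, G u := by
    rw [integral_const_mul, integral_sub_right_eq_self (fun x => G (x / z.im)) z.re,
      Measure.integral_comp_div, abs_of_pos hz, smul_eq_mul, ← mul_assoc]
    congr 1
    rw [Real.rpow_neg hz.le, ← Real.sqrt_eq_rpow, hc]
    have h1 := Real.sq_sqrt hz.le
    have h2 := Real.sqrt_pos.2 hz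
    field_simp
    exact h1
  have hb : ‖deriv mSC z‖ ≤ z.im ^ (-(1 / 2 : ℝ)) * ∫ u, G u := by
    rw [e, ← hint]
    refine norm_integral_le_of_norm_le hgi (Filter.Eventually.of_forall fun x => ?_)
    rw [← sub_mul, norm_mul, aux_norm x z hz, ← Complex.ofReal_sub, Complex.norm_real,
      Real.norm_eq_abs]
    have h1 := aux_holder x z.re
    have h2 : Real.sqrt |x - z.re| = Real.sqrt z.im * Real.sqrt |(x - z.re) / z.im| := by
      rw [← Real.sqrt_mul hz.le, abs_div, abs_of_pos hz, mul_div_cancel₀ _ hz.ne']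
    calc _ ≤ Real.sqrt |x - z.re| * ((z.im ^ 2)⁻¹ * (1 + ((x - z.re) / z.im) ^ 2)⁻¹) := by gcongr
      _ = c * (Real.sqrt |(x - z.re) / z.im| * (1 + ((x - z.re) / z.im) ^ 2)⁻¹) := by
        rw [h2, hc]; ring
      _ ≤ _ := by
        have := aux_pt ((x - z.re) / z.im)
        have hc0 : 0 ≤ c := by positivity
        exact mul_le_mul_of_nonneg_left this hc0
  have : 0 ≤ z.im ^ (-(1 / 2 : ℝ)) := Real.rpow_nonneg hz.le _
  linarith
end
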